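/- The DFA ℬ₂′ admits no uniform winning strategy: for every word a₁a₂⋯aₙ over the alphabet {a,b,c} there exist letters b₁,…,bₙ ∈ {a,b,c} such that the interleaved word a₁b₁a₂b₂⋯aₙbₙ is not a reset word for ℬ₂′, i.e., the set {q·(a₁b₁⋯aₙbₙ) : q ∈ {0,1,2}} contains at least two states. -/

import Mathlib

open MulOpposite

variable {Q σ : Type*}

/-- The action of a word on a state: `q·w`. -/
def run (step : Q → σ → Q) (q : Q) (w : List σ) : Q := w.foldl step q

/-- A reset word. -/
def IsReset (step : Q → σ → Q) (w : List σ) : Prop :=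
  ∀ p q : Q, run step p w = run step q w

/-- The interleaving `a₁b₁a₂b₂⋯` of two words. -/
def interleave {α : Type*} (as bs : List α) : List α :=
  (as.zip bs).flatMap fun p => [p.1, p.2]

/-- The input alphabet `{a, b, c}`. -/
inductive Letter : Type
  | a | b | c
deriving DecidableEq

open Letter

/-- The transition function of the automaton ℬ₂′ on states `{0, 1, 2}` (as `Fin 3`):
under `a`: 0↦0, 1↦2, 2↦0; under `b`: 0↦0, 1↦0, 2↦1; `c` is the identity. -/
def stepB2' : Fin 3 → Letter → Fin 3
  | q, .a => ![0, 2, 0] q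
  | q, .b => ![0, 0, 1] q
  | q, .c => q

theorem key_step : ∀ (x : Letter) (p' : Fin 3), p' ≠ 0 →
    ∃ (p : Fin 3) (y : Letter), p ≠ 0 ∧ stepB2' (stepB2' p x) y = p' := by
  intro x p' h
  have h' : p' = 1 ∨ p' = 2 := by omega
  rcases h' with rfl | rfl
  · cases x
    · exact ⟨1, .b, by decide, by decide⟩
    · exact ⟨2, .c, by decide, by decide⟩
    · exact ⟨1, .c, by decide, by decide⟩
  · cases x
    · exact ⟨1, .c, by decide, by decide⟩
    · exact ⟨2, .a, by decide, by decide⟩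
    · exact ⟨2, .c, by decide, by decide⟩

theorem key_zero (w : List Letter) : run stepB2' 0 w = 0 := by
  induction w with
  | nil => rfl
  | cons x w ih => cases x <;> exact ih

theorem key_run (as : List Letter) : ∃ bs : List Letter, bs.length = as.length ∧
    ∃ p : Fin 3, p ≠ 0 ∧ run stepB2' p (interleave as bs) ≠ 0 := by
  induction as with
  | nil => exact ⟨[], rfl, 1, by decide, by decide⟩
  | cons x as ih =>
    obtain ⟨bs, hl, p', hp', hr⟩ := ih
    obtain ⟨p, y, hp, hxy⟩ := key_step x p' hp'
    refine ⟨y :: bs, by simp [hl], p, hp, ?_⟩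
    subst hxy
    exact hr

/-- The DFA ℬ₂′ admits no uniform winning strategy: for every
word over `{a,b,c}` there are responses of Bob such that the interleaved word is
not a reset word, i.e. sends two states to distinct states. -/
theorem B2'_no_uniform_winning_strategy :
    ∀ as : List Letter, ∃ bs : List Letter, bs.length = as.length ∧
      ∃ p q : Fin 3,
        run stepB2' p (interleave as bs) ≠ run stepB2' q (interleave as bs) := by
  intro as
  obtain ⟨bs, hl, p, _, hr⟩ := key_run as
  exact ⟨bs, hl, p, 0, by rw [key_zero]; exact hr⟩
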